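/- Let q₁ and q₂ be homogeneous polynomials of degree 2 in the polynomial ring ℂ[X,Y,Z,W] which have no common non-unit factor, and suppose that every nonzero element of the ℂ-linear span of {q₁, q₂} is reducible (i.e., not irreducible) in ℂ[X,Y,Z,W]. Then there exist homogeneous polynomials u, v of degree 1 in ℂ[X,Y,Z,W], linearly independent over ℂ, such that both q₁ and q₂ lie in the ℂ-subalgebra of ℂ[X,Y,Z,W] generated by u and v. -/

import Mathlib

open MvPolynomial

section LinearForms

open Matrix

variable {K σ : Type*} [Field K] [Fintype σ]

/-- The linear form `∑ i, a i • X i` with coefficient vector `a`. -/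
noncomputable def linearForm : (σ → K) →ₗ[K] MvPolynomial σ K :=
  Fintype.linearCombination K X

lemma eval_linearForm (a x : σ → K) : eval x (linearForm a) = a ⬝ᵥ x := by
  simp [linearForm, Fintype.linearCombination_apply, dotProduct, smul_eval]

lemma linearForm_injective : Function.Injective (linearForm (K := K) (σ := σ)) := by
  classical
  intro a b h
  funext i
  simpa [eval_linearForm] using congrArg (eval (Pi.single i 1)) h

lemma range_linearForm :
    LinearMap.range (linearForm (K := K) (σ := σ)) = homogeneousSubmodule σ K 1 := by
  rw [linearForm, Fintype.range_linearCombination, homogeneousSubmodule_one_eq_span_X]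

lemma isHomogeneous_linearForm (a : σ → K) : (linearForm a).IsHomogeneous 1 := by
  rw [← mem_homogeneousSubmodule, ← range_linearForm]
  exact LinearMap.mem_range_self _ a

lemma MvPolynomial.IsHomogeneous.exists_eq_linearForm {p : MvPolynomial σ K}
    (hp : p.IsHomogeneous 1) : ∃ a, p = linearForm a := by
  rw [← mem_homogeneousSubmodule, ← range_linearForm] at hp
  obtain ⟨a, rfl⟩ := hp
  exact ⟨a, rfl⟩

lemma not_isUnit_linearForm (a : σ → K) : ¬ IsUnit (linearForm a) := by
  intro h
  have h0 := h.map (eval (0 : σ → K))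
  rw [eval_linearForm, dotProduct_zero] at h0
  exact not_isUnit_zero h0

/-- A polynomial of total degree at most one is a constant plus a linear form. -/
lemma exists_eq_C_add_linearForm {p : MvPolynomial σ K} (hp : p.totalDegree ≤ 1) :
    ∃ r a, p = C r + linearForm a := by
  obtain ⟨a, ha⟩ := (homogeneousComponent_isHomogeneous 1 p).exists_eq_linearForm
  refine ⟨coeff 0 p, a, ?_⟩
  rw [← ha, ← homogeneousComponent_zero]
  calc p = ∑ i ∈ Finset.range (p.totalDegree + 1), homogeneousComponent i p :=
        (sum_homogeneousComponent p).symm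
    _ = ∑ i ∈ Finset.range 2, homogeneousComponent i p := by
        refine Finset.sum_subset (Finset.range_subset_range.2 (by omega)) fun i _ hi ↦ ?_
        exact homogeneousComponent_eq_zero _ _ (by simpa using hi)
    _ = homogeneousComponent 0 p + homogeneousComponent 1 p := by
        simp [Finset.sum_range_succ]

/-- A quadratic form that is zero or reducible is a product of two linear forms. -/
lemma MvPolynomial.IsHomogeneous.exists_eq_linearForm_mul {f : MvPolynomial σ K}
    (hf : f.IsHomogeneous 2) (hred : f ≠ 0 → ¬ Irreducible f) :
    ∃ l m, f = linearForm l * linearForm m := by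
  rcases eq_or_ne f 0 with rfl | h0
  · exact ⟨0, 0, by simp⟩
  have hdeg := hf.totalDegree h0
  have hunit : ¬ IsUnit f := fun h ↦ by
    rw [isUnit_iff_totalDegree_of_isReduced] at h
    omega
  have hfac : ∃ p q, f = p * q ∧ ¬ IsUnit p ∧ ¬ IsUnit q := by
    by_contra! h
    refine hred h0 ⟨hunit, fun p q hpq ↦ ?_⟩
    by_contra! hn
    exact hn.2 (h p q hpq hn.1)
  obtain ⟨p, q, rfl, hp, hq⟩ := hfac
  have hp0 := left_ne_zero_of_mul h0
  have hq0 := right_ne_zero_of_mul h0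
  have pos {g : MvPolynomial σ K} (h : g ≠ 0) (hg : ¬ IsUnit g) : g.totalDegree ≠ 0 := by
    intro hd
    rw [totalDegree_eq_zero_iff_eq_C] at hd
    rw [hd] at h hg
    exact hg ((isUnit_iff_ne_zero.2 fun hc ↦ h (by rw [hc, C_0])).map C)
  have hp1 := pos hp0 hp
  have hq1 := pos hq0 hq
  rw [totalDegree_mul_of_isDomain hp0 hq0] at hdeg
  obtain ⟨r, l, rfl⟩ := exists_eq_C_add_linearForm (p := p) (by omega)
  obtain ⟨s, m, rfl⟩ := exists_eq_C_add_linearForm (p := q) (by omega)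
  refine ⟨l, m, ?_⟩
  have hlm := (isHomogeneous_linearForm l).mul (isHomogeneous_linearForm m)
  have h1 : (C r * linearForm m + C s * linearForm l).IsHomogeneous 1 :=
    ((isHomogeneous_linearForm m).C_mul r).add ((isHomogeneous_linearForm l).C_mul s)
  rw [← homogeneousComponent_eq_self hf]
  have : (C r + linearForm l) * (C s + linearForm m) =
      C (r * s) + (C r * linearForm m + C s * linearForm l) + linearForm l * linearForm m := by
    rw [map_mul]; ring
  rw [this, map_add, map_add, homogeneousComponent_of_mem (isHomogeneous_C σ (r * s)),
    homogeneousComponent_of_mem h1, homogeneousComponent_of_mem hlm]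
  simp

/-- Linearly independent covectors take arbitrary prescribed values at a suitable point. -/
lemma LinearIndependent.exists_dotProduct_eq {k : ℕ} {v : Fin k → σ → K}
    (hv : LinearIndependent K v) (w : Fin k → K) : ∃ x, ∀ i, v i ⬝ᵥ x = w i := by
  have hr : (Matrix.of v).rank = k := by
    simpa using LinearIndependent.rank_matrix (M := Matrix.of v) hv
  have htop : LinearMap.range (Matrix.of v).mulVecLin = ⊤ := by
    apply Submodule.eq_top_of_finrank_eq
    rw [← Matrix.rank, hr]
    simp
  obtain ⟨x, hx⟩ := LinearMap.range_eq_top.1 htop w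
  exact ⟨x, fun i ↦ congrFun hx i⟩

/-- The polar form of a product of two linear forms has vanishing `3 × 3` Gram determinants. -/
lemma gram_det_eq_zero [CharZero K] {a b c d l m : σ → K} {t : K}
    (h : linearForm a * linearForm b + C t * (linearForm c * linearForm d) =
      linearForm l * linearForm m) (x : Fin 3 → σ → K) :
    (Matrix.of fun i j ↦ (a ⬝ᵥ x i) * (b ⬝ᵥ x j) + (a ⬝ᵥ x j) * (b ⬝ᵥ x i) +
      t * ((c ⬝ᵥ x i) * (d ⬝ᵥ x j) + (c ⬝ᵥ x j) * (d ⬝ᵥ x i))).det = 0 := by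
  have hev (y : σ → K) : (a ⬝ᵥ y) * (b ⬝ᵥ y) + t * ((c ⬝ᵥ y) * (d ⬝ᵥ y)) =
      (l ⬝ᵥ y) * (m ⬝ᵥ y) := by
    simpa [eval_linearForm] using congrArg (eval y) h
  have hpol (y z : σ → K) : (a ⬝ᵥ y) * (b ⬝ᵥ z) + (a ⬝ᵥ z) * (b ⬝ᵥ y) +
      t * ((c ⬝ᵥ y) * (d ⬝ᵥ z) + (c ⬝ᵥ z) * (d ⬝ᵥ y)) =
      (l ⬝ᵥ y) * (m ⬝ᵥ z) + (l ⬝ᵥ z) * (m ⬝ᵥ y) := by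
    have h1 := hev (y + z)
    simp only [dotProduct_add] at h1
    linear_combination h1 - hev y - hev z
  simp only [hpol, Matrix.det_fin_three, Matrix.of_apply]
  ring

/-- If `a`, `b` are independent and every `ab + t cd` is a product of two linear forms,
then `c ∈ span {a, b}` or `d` is proportional to `a` or `b`. -/
lemma mem_span_pair_or_exists_smul [CharZero K] {a b c d : σ → K}
    (hab : LinearIndependent K ![a, b])
    (h : ∀ t : K, ∃ l m, linearForm a * linearForm b + C t * (linearForm c * linearForm d) =
      linearForm l * linearForm m) :
    c ∈ Submodule.span K {a, b} ∨ (∃ s : K, d = s • a) ∨ ∃ s : K, d = s • b := by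
  by_contra! hcon
  obtain ⟨hc, hda, hdb⟩ := hcon
  have hcab : LinearIndependent K ![c, a, b] :=
    linearIndependent_finCons.2 ⟨hab, by simpa only [Matrix.range_cons, Matrix.range_empty, Set.union_empty,
      Set.singleton_union] using hc⟩
  have key (x : Fin 3 → σ → K) (h00 : a ⬝ᵥ x 0 = 1) (h10 : b ⬝ᵥ x 0 = 0) (h01 : a ⬝ᵥ x 1 = 0)
      (h11 : b ⬝ᵥ x 1 = 1) (h02 : a ⬝ᵥ x 2 = 0) (h12 : b ⬝ᵥ x 2 = 0) (h20 : c ⬝ᵥ x 0 = 0)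
      (h21 : c ⬝ᵥ x 1 = 0) (h22 : c ⬝ᵥ x 2 = 1) :
      d ⬝ᵥ x 2 = 0 ∧ (d ⬝ᵥ x 0) * (d ⬝ᵥ x 1) = 0 := by
    obtain ⟨l, m, h1⟩ := h 1
    obtain ⟨l', m', h2⟩ := h (-1)
    have e1 := gram_det_eq_zero h1 x
    have e2 := gram_det_eq_zero h2 x
    simp only [Matrix.det_fin_three, Matrix.of_apply, h00, h10, h01, h11, h02, h12, h20, h21,
      h22] at e1 e2
    constructor
    · linear_combination (e2 - e1) / 4
    · linear_combination (e1 + e2) / 4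
  obtain ⟨x₀, hx₀⟩ := hcab.exists_dotProduct_eq ![0, 1, 0]
  obtain ⟨x₁, hx₁⟩ := hcab.exists_dotProduct_eq ![0, 0, 1]
  simp only [Fin.forall_fin_succ, IsEmpty.forall_iff, and_true] at hx₀ hx₁
  by_cases hd : d ∈ Submodule.span K {c, a, b}
  · obtain ⟨γ, α, β, rfl⟩ := Submodule.mem_span_triple.1 hd
    obtain ⟨x₂, hx₂⟩ := hcab.exists_dotProduct_eq ![1, 0, 0]
    simp only [Fin.forall_fin_succ, IsEmpty.forall_iff, and_true] at hx₂
    have := key ![x₀, x₁, x₂] hx₀.2.1 hx₀.2.2 hx₁.2.1 hx₁.2.2 hx₂.2.1 hx₂.2.2 hx₀.1 hx₁.1 hx₂.1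
    simp at hx₀ hx₁ hx₂
    simp [add_dotProduct, hx₀, hx₁, hx₂] at this
    obtain ⟨rfl, rfl | rfl⟩ := this
    · exact hdb β (by simp)
    · exact hda α (by simp)
  · have hdcab : LinearIndependent K ![d, c, a, b] :=
      linearIndependent_finCons.2 ⟨hcab, by simpa only [Matrix.range_cons, Matrix.range_empty, Set.union_empty,
        Set.singleton_union] using hd⟩
    obtain ⟨x₂, hx₂⟩ := hdcab.exists_dotProduct_eq ![1, 1, 0, 0]
    simp only [Fin.forall_fin_succ, IsEmpty.forall_iff, and_true] at hx₂
    have := key ![x₀, x₁, x₂] hx₀.2.1 hx₀.2.2 hx₁.2.1 hx₁.2.2 hx₂.2.2.1 hx₂.2.2.2 hx₀.1 hx₁.1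
      hx₂.2.1
    exact one_ne_zero (hx₂.1.symm.trans this.1)

/-- If `a`, `b` are independent, `ab` and `cd` are coprime, and every `ab + t cd` is a product of
linear forms, then `c` and `d` lie in the span of `a` and `b`. -/
lemma mem_span_pair_of_coprime [CharZero K] {a b c d : σ → K}
    (hab : LinearIndependent K ![a, b])
    (hcop : ∀ r : MvPolynomial σ K, r ∣ linearForm a * linearForm b →
      r ∣ linearForm c * linearForm d → IsUnit r)
    (h : ∀ t : K, ∃ l m, linearForm a * linearForm b + C t * (linearForm c * linearForm d) =
      linearForm l * linearForm m) :
    c ∈ Submodule.span K {a, b} ∧ d ∈ Submodule.span K {a, b} := by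
  have aux {c d : σ → K}
      (hcop : ∀ r : MvPolynomial σ K, r ∣ linearForm a * linearForm b →
        r ∣ linearForm c * linearForm d → IsUnit r)
      (h : ∀ t : K, ∃ l m, linearForm a * linearForm b + C t * (linearForm c * linearForm d) =
        linearForm l * linearForm m) : c ∈ Submodule.span K {a, b} := by
    rcases mem_span_pair_or_exists_smul hab h with hc | ⟨s, rfl⟩ | ⟨s, rfl⟩
    · exact hc
    · refine absurd (hcop (linearForm a) (Dvd.intro _ rfl) ?_) (not_isUnit_linearForm a)
      rw [map_smul, smul_eq_C_mul]
      exact ((dvd_refl _).mul_left _).mul_left _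
    · refine absurd (hcop (linearForm b) (Dvd.intro_left _ rfl) ?_) (not_isUnit_linearForm b)
      rw [map_smul, smul_eq_C_mul]
      exact ((dvd_refl _).mul_left _).mul_left _
  refine ⟨aux hcop h, aux (c := d) (d := c) ?_ ?_⟩
  · rwa [mul_comm (linearForm d)]
  · rwa [mul_comm (linearForm d)]

lemma linearForm_mem_adjoin {a b c : σ → K} (hc : c ∈ Submodule.span K {a, b}) :
    linearForm c ∈ Algebra.adjoin K ({linearForm a, linearForm b} : Set (MvPolynomial σ K)) := by
  apply Algebra.span_le_adjoin
  have := Submodule.mem_map_of_mem (f := linearForm) hc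
  rwa [Submodule.map_span, Set.image_pair] at this

lemma linearIndependent_linearForm {a b : σ → K} (hab : LinearIndependent K ![a, b]) :
    LinearIndependent K ![linearForm a, linearForm b] := by
  have h : ![linearForm a, linearForm b] = linearForm ∘ ![a, b] := by
    ext i : 1
    fin_cases i <;> rfl
  rw [h]
  exact hab.map' linearForm (LinearMap.ker_eq_bot.2 linearForm_injective)

/-- Dependent vectors with `a ≠ 0` are proportional. -/
lemma exists_smul_eq_of_not_linearIndependent {V : Type*} [AddCommGroup V] [Module K V]
    {a b : V} (ha : a ≠ 0)
    (hab : ¬ LinearIndependent K ![a, b]) : ∃ s : K, s • a = b := by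
  simpa [LinearIndependent.pair_iff' ha] using hab

end LinearForms

/-- Claim 4 (normal form of a pencil of reducible quadrics): if `q₁, q₂` are coprime
quadratic forms in `ℂ[X,Y,Z,W]` such that every nonzero element of their `ℂ`-linear span
is reducible, then there exist linearly independent linear forms `u, v` such that
`q₁, q₂ ∈ ℂ[u, v]`. -/
theorem stmt3 (q₁ q₂ : MvPolynomial (Fin 4) ℂ)
    (h₁ : q₁.IsHomogeneous 2) (h₂ : q₂.IsHomogeneous 2)
    (hcop : ∀ r : MvPolynomial (Fin 4) ℂ, r ∣ q₁ → r ∣ q₂ → IsUnit r)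
    (hred : ∀ f ∈ Submodule.span ℂ ({q₁, q₂} : Set (MvPolynomial (Fin 4) ℂ)),
      f ≠ 0 → ¬ Irreducible f) :
    ∃ u v : MvPolynomial (Fin 4) ℂ, u.IsHomogeneous 1 ∧ v.IsHomogeneous 1 ∧
      LinearIndependent ℂ ![u, v] ∧
      q₁ ∈ Algebra.adjoin ℂ ({u, v} : Set (MvPolynomial (Fin 4) ℂ)) ∧
      q₂ ∈ Algebra.adjoin ℂ ({u, v} : Set (MvPolynomial (Fin 4) ℂ)) := by
  have hpencil (s t : ℂ) : ∃ l m, C s * q₁ + C t * q₂ = linearForm l * linearForm m :=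
    ((h₁.C_mul s).add (h₂.C_mul t)).exists_eq_linearForm_mul <| hred _ <|
      Submodule.mem_span_pair.2 ⟨s, t, by simp only [smul_eq_C_mul]⟩
  obtain ⟨a, b, rfl⟩ : ∃ a b, q₁ = linearForm a * linearForm b := by simpa using hpencil 1 0
  obtain ⟨c, d, rfl⟩ : ∃ c d, q₂ = linearForm c * linearForm d := by simpa using hpencil 0 1
  have conclude {u v : Fin 4 → ℂ} (huv : LinearIndependent ℂ ![u, v])
      (ha : a ∈ Submodule.span ℂ {u, v}) (hb : b ∈ Submodule.span ℂ {u, v})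
      (hc : c ∈ Submodule.span ℂ {u, v}) (hd : d ∈ Submodule.span ℂ {u, v}) :
      ∃ u v : MvPolynomial (Fin 4) ℂ, u.IsHomogeneous 1 ∧ v.IsHomogeneous 1 ∧
        LinearIndependent ℂ ![u, v] ∧
        linearForm a * linearForm b ∈ Algebra.adjoin ℂ ({u, v} : Set (MvPolynomial (Fin 4) ℂ)) ∧
        linearForm c * linearForm d ∈ Algebra.adjoin ℂ ({u, v} : Set (MvPolynomial (Fin 4) ℂ)) :=
    ⟨linearForm u, linearForm v, isHomogeneous_linearForm u, isHomogeneous_linearForm v,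
      linearIndependent_linearForm huv,
      mul_mem (linearForm_mem_adjoin ha) (linearForm_mem_adjoin hb),
      mul_mem (linearForm_mem_adjoin hc) (linearForm_mem_adjoin hd)⟩
  have left_mem (u v : Fin 4 → ℂ) : u ∈ Submodule.span ℂ {u, v} :=
    Submodule.subset_span (by simp)
  have right_mem (u v : Fin 4 → ℂ) : v ∈ Submodule.span ℂ {u, v} :=
    Submodule.subset_span (by simp)
  by_cases hab : LinearIndependent ℂ ![a, b]
  · obtain ⟨hc, hd⟩ := mem_span_pair_of_coprime hab hcop fun t ↦ by simpa using hpencil 1 t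
    exact conclude hab (left_mem a b) (right_mem a b) hc hd
  by_cases hcd : LinearIndependent ℂ ![c, d]
  · obtain ⟨ha, hb⟩ := mem_span_pair_of_coprime hcd (fun r hr hr' ↦ hcop r hr' hr) fun t ↦ by
      simpa [add_comm] using hpencil t 1
    exact conclude hcd ha hb (left_mem c d) (right_mem c d)
  have ha : a ≠ 0 := by
    rintro rfl
    exact not_isUnit_linearForm c (hcop _ (by simp) (Dvd.intro _ rfl))
  have hc : c ≠ 0 := by
    rintro rfl
    exact not_isUnit_linearForm a (hcop _ (Dvd.intro _ rfl) (by simp))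
  obtain ⟨s, rfl⟩ := exists_smul_eq_of_not_linearIndependent ha hab
  obtain ⟨t, rfl⟩ := exists_smul_eq_of_not_linearIndependent hc hcd
  have hac : LinearIndependent ℂ ![a, c] := by
    by_contra hac
    obtain ⟨r, rfl⟩ := exists_smul_eq_of_not_linearIndependent ha hac
    refine not_isUnit_linearForm a (hcop _ (Dvd.intro _ rfl) ?_)
    rw [map_smul, smul_eq_C_mul]
    exact ((dvd_refl _).mul_left _).mul_right _
  exact conclude hac (left_mem a c) (Submodule.smul_mem _ _ (left_mem a c)) (right_mem a c)
    (Submodule.smul_mem _ _ (right_mem a c))
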